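/- Let Q ∈ ℂ with |Q| > 1, λ ∈ ℂ*, and ℓ ∈ ℕ. For every z ∈ ℂ* ∖ (−λQ^ℤ), the series Σ_{k∈ℤ} (Q^k λ)^ℓ / Θ_Q(Q^{k+1}λ/z) converges absolutely and its sum equals Q^{ℓ(ℓ−1)/2} · z^ℓ. -/

import Mathlib

/-- The theta function `Θ_Q(z) = Σ_{ℓ ∈ ℤ} Q^(-ℓ(ℓ+1)/2) z^ℓ`. -/
noncomputable def theta (Q z : ℂ) : ℂ := ∑' ℓ : ℤ, Q ^ (-(ℓ * (ℓ + 1)) / 2) * z ^ ℓ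

open Filter Topology Finset

/-- The Gaussian binomial coefficient, defined through its `q`-Pascal recursion. -/
noncomputable def gaussBinom (q : ℂ) : ℕ → ℕ → ℂ
  | _, 0 => 1
  | 0, _ + 1 => 0
  | n + 1, m + 1 => gaussBinom q n m + q ^ (m + 1) * gaussBinom q n (m + 1)

lemma gaussBinom_zero_right (q : ℂ) (n : ℕ) : gaussBinom q n 0 = 1 := by
  cases n <;> rfl

lemma gaussBinom_eq_zero (q : ℂ) {n m : ℕ} (h : n < m) : gaussBinom q n m = 0 := by
  induction n generalizing m with
  | zero =>
    obtain ⟨m, rfl⟩ := Nat.exists_eq_succ_of_ne_zero h.ne'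
    rfl
  | succ n ih =>
    obtain ⟨m, rfl⟩ := Nat.exists_eq_succ_of_ne_zero (Nat.ne_zero_of_lt h)
    rw [gaussBinom, ih (by omega), ih (by omega)]
    simp

/-- The finite `q`-Pochhammer symbol `(q; q)_n`. -/
noncomputable def qPoch (q : ℂ) (n : ℕ) : ℂ := ∏ j ∈ range n, (1 - q ^ (j + 1))

lemma qPoch_succ (q : ℂ) (n : ℕ) : qPoch q (n + 1) = qPoch q n * (1 - q ^ (n + 1)) :=
  prod_range_succ _ _

lemma gaussBinom_mul_qPoch (q : ℂ) (m j : ℕ) :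
    gaussBinom q (m + j) m * qPoch q m * qPoch q j = qPoch q (m + j) := by
  induction hN : m + j generalizing m j with
  | zero =>
    obtain ⟨rfl, rfl⟩ : m = 0 ∧ j = 0 := by omega
    simp [gaussBinom, qPoch]
  | succ N ih =>
    rcases m with _ | m
    · obtain rfl : j = N + 1 := by omega
      simp [gaussBinom, qPoch]
    rcases j with _ | j
    · obtain rfl : m = N := by omega
      have h := ih m 0 (by omega)
      simp only [qPoch, range_zero, prod_empty, mul_one] at h
      rw [gaussBinom, gaussBinom_eq_zero q (Nat.lt_succ_self m), qPoch_succ]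
      simp only [qPoch, range_zero, prod_empty, mul_one, mul_zero, add_zero]
      linear_combination (1 - q ^ (m + 1)) * h
    · obtain rfl : N = m + j + 1 := by omega
      have h1 := ih m (j + 1) (by omega)
      have h2 := ih (m + 1) j (by omega)
      rw [gaussBinom]
      rw [qPoch_succ q j] at h1 ⊢
      rw [qPoch_succ q m] at h2 ⊢
      rw [qPoch_succ q (m + j + 1)]
      linear_combination (1 - q ^ (m + 1)) * h1 + q ^ (m + 1) * (1 - q ^ (j + 1)) * h2

/-- The finite `q`-binomial theorem. -/
lemma prod_one_add_pow_mul (q x : ℂ) (n : ℕ) :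
    ∏ j ∈ range n, (1 + q ^ j * x) =
      ∑ m ∈ range (n + 1), gaussBinom q n m * q ^ m.choose 2 * x ^ m := by
  induction n generalizing x with
  | zero => simp [gaussBinom]
  | succ n ih =>
    have h0 : ∏ j ∈ range (n + 1), (1 + q ^ j * x) =
        (∏ j ∈ range n, (1 + q ^ j * (q * x))) * (1 + x) := by
      rw [prod_range_succ']
      simp only [pow_zero, one_mul]
      congr 1
      exact prod_congr rfl fun j _ => by ring
    have h1 : ∑ m ∈ range (n + 1), gaussBinom q n m * q ^ m.choose 2 * (q * x) ^ m =
        ∑ m ∈ range (n + 1), gaussBinom q n (m + 1) * q ^ (m + 1).choose 2 * (q * x) ^ (m + 1)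
          + 1 := by
      have h := sum_range_succ (fun m => gaussBinom q n m * q ^ m.choose 2 * (q * x) ^ m) (n + 1)
      rw [sum_range_succ'] at h
      simpa [gaussBinom_eq_zero q (Nat.lt_succ_self n), gaussBinom_zero_right] using h.symm
    rw [h0, ih, mul_add, mul_one, sum_range_succ' _ (n + 1)]
    nth_rewrite 1 [h1]
    rw [gaussBinom_zero_right, sum_mul, add_right_comm, ← sum_add_distrib]
    congr 1
    · refine sum_congr rfl fun m _ => ?_
      have hc : (m + 1).choose 2 = m + m.choose 2 := by simp [Nat.choose_succ_succ' m 1]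
      rw [gaussBinom, hc]
      ring
    · simp

lemma two_mul_choose_two (n : ℕ) : 2 * ((n.choose 2 : ℕ) : ℤ) = n * (n - 1) := by
  induction n with
  | zero => simp
  | succ n ih =>
    have hc : (n + 1).choose 2 = n + n.choose 2 := by simp [Nat.choose_succ_succ' n 1]
    rw [hc]
    push_cast
    linarith

lemma two_mul_theta_exponent (k : ℤ) : 2 * (-(k * (k + 1)) / 2) = -(k * (k + 1)) :=
  Int.mul_ediv_cancel' ((Int.even_mul_succ_self k).two_dvd.neg_right)

lemma summable_theta_term {Q : ℂ} (hQ : 1 < ‖Q‖) {z : ℂ} (hz : z ≠ 0) :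
    Summable fun k : ℤ => Q ^ (-(k * (k + 1)) / 2) * z ^ k := by
  have hQ0 : Q ≠ 0 := norm_pos_iff.mp (by linarith)
  have hpi : (Real.pi : ℂ) ≠ 0 := by exact_mod_cast Real.pi_ne_zero
  set τ : ℂ := Complex.I * Complex.log Q / (2 * Real.pi) with hτ
  set w : ℂ := (Complex.log z - Complex.log Q / 2) / (2 * Real.pi * Complex.I) with hw
  have him : 0 < τ.im := by
    have : τ = ((1 / (2 * Real.pi) : ℝ) : ℂ) * (Complex.I * Complex.log Q) := by
      rw [hτ]; push_cast; ring
    rw [this, Complex.im_ofReal_mul, Complex.I_mul_im, Complex.log_re]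
    have := Real.log_pos hQ
    positivity
  refine ((summable_jacobiTheta₂_term_iff w τ).2 him).congr fun k => ?_
  have hk : ((-(k * (k + 1)) / 2 : ℤ) : ℂ) = -(k * (k + 1)) / 2 := by
    have h := congrArg (Int.cast : ℤ → ℂ) (two_mul_theta_exponent k)
    push_cast at h
    linear_combination h / 2
  have hpow {x : ℂ} (hx : x ≠ 0) (j : ℤ) : x ^ j = Complex.exp (j * Complex.log x) := by
    rw [Complex.exp_int_mul, Complex.exp_log hx]
  rw [jacobiTheta₂_term, hpow hQ0, hpow hz, hk, ← Complex.exp_add]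
  congr 1
  rw [hτ, hw]
  field_simp
  linear_combination (k : ℂ) ^ 2 * Complex.log Q * Complex.I_sq

lemma theta_zpow_mul {Q : ℂ} (hQ0 : Q ≠ 0) {z : ℂ} (hz : z ≠ 0) (k : ℤ) :
    theta Q (Q ^ k * z) = Q ^ (-(k * (k + 1)) / 2 + k * k) * z ^ k * theta Q z := by
  rw [theta, theta, ← tsum_mul_left, ← (Equiv.addRight k).tsum_eq]
  refine tsum_congr fun m => ?_
  have h1 := two_mul_theta_exponent m
  have h2 := two_mul_theta_exponent k
  have h3 := two_mul_theta_exponent (m + k)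
  have h : -((m + k) * (m + k + 1)) / 2 + k * (m + k) =
      -(k * (k + 1)) / 2 + k * k + -(m * (m + 1)) / 2 := by linarith
  rw [Equiv.coe_addRight, mul_zpow, ← zpow_mul, ← mul_assoc, ← zpow_add₀ hQ0, h,
    zpow_add₀ hQ0 _ (-(m * (m + 1)) / 2), zpow_add₀ hz]
  ring

lemma summable_norm_mul_pow {q : ℂ} (hq : ‖q‖ < 1) (c : ℂ) :
    Summable fun j : ℕ => ‖c * q ^ j‖ := by
  simp only [norm_mul, norm_pow]
  exact (summable_geometric_of_lt_one (norm_nonneg _) hq).mul_left _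

lemma exists_tendsto_prod_one_add {q : ℂ} (hq : ‖q‖ < 1) {c : ℂ}
    (hc : ∀ j : ℕ, 1 + c * q ^ j ≠ 0) :
    ∃ L : ℂ, L ≠ 0 ∧ Tendsto (fun n => ∏ j ∈ range n, (1 + c * q ^ j)) atTop (𝓝 L) :=
  ⟨_, tprod_one_add_ne_zero_of_summable hc (summable_norm_mul_pow hq c),
    (multipliable_one_add_of_summable (summable_norm_mul_pow hq c)).hasProd.tendsto_prod_nat⟩

lemma one_sub_pow_ne_zero {q : ℂ} (hq : ‖q‖ < 1) (j : ℕ) : 1 - q ^ (j + 1) ≠ 0 := by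
  intro h
  have h1 : ‖q‖ ^ (j + 1) = 1 := by rw [← norm_pow, ← sub_eq_zero.mp h, norm_one]
  exact (pow_lt_one₀ (norm_nonneg q) hq j.succ_ne_zero).ne h1

lemma qPoch_ne_zero {q : ℂ} (hq : ‖q‖ < 1) (n : ℕ) : qPoch q n ≠ 0 :=
  prod_ne_zero_iff.2 fun j _ => one_sub_pow_ne_zero hq j

lemma exists_tendsto_qPoch {q : ℂ} (hq : ‖q‖ < 1) :
    ∃ L : ℂ, L ≠ 0 ∧ Tendsto (qPoch q) atTop (𝓝 L) := by
  have h (j : ℕ) : 1 + -q * q ^ j = 1 - q ^ (j + 1) := by ring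
  have h' := exists_tendsto_prod_one_add hq (c := -q) fun j => h j ▸ one_sub_pow_ne_zero hq j
  simp only [h] at h'
  exact h'

lemma gaussBinom_eq_div {q : ℂ} (hq : ‖q‖ < 1) (m j : ℕ) :
    gaussBinom q (m + j) m = qPoch q (m + j) / (qPoch q m * qPoch q j) := by
  rw [eq_div_iff (mul_ne_zero (qPoch_ne_zero hq m) (qPoch_ne_zero hq j)), ← mul_assoc,
    gaussBinom_mul_qPoch]

lemma exists_norm_le_of_tendsto {u : ℕ → ℂ} {L : ℂ} (h : Tendsto u atTop (𝓝 L)) :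
    ∃ C, ∀ n, ‖u n‖ ≤ C := by
  obtain ⟨C, hC⟩ := (Metric.isBounded_range_of_tendsto u h).exists_norm_le
  exact ⟨C, fun n => hC _ ⟨n, rfl⟩⟩

lemma exists_norm_gaussBinom_le {q : ℂ} (hq : ‖q‖ < 1) :
    ∃ C, ∀ n m, ‖gaussBinom q n m‖ ≤ C := by
  obtain ⟨L, hL0, hL⟩ := exists_tendsto_qPoch hq
  obtain ⟨C, hC⟩ := exists_norm_le_of_tendsto hL
  obtain ⟨D, hD⟩ := exists_norm_le_of_tendsto (hL.inv₀ hL0)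
  have hC0 : 0 ≤ C := (norm_nonneg _).trans (hC 0)
  have hD0 : 0 ≤ D := (norm_nonneg _).trans (hD 0)
  refine ⟨C * (D * D), fun n m => ?_⟩
  rcases lt_or_ge n m with h | h
  · rw [gaussBinom_eq_zero q h, norm_zero]
    positivity
  · obtain ⟨j, rfl⟩ := Nat.exists_eq_add_of_le h
    rw [gaussBinom_eq_div hq, div_eq_mul_inv, mul_inv, norm_mul, norm_mul]
    gcongr
    exacts [hC _, hD _, hD _]

lemma tendsto_gaussBinom_central {q : ℂ} (hq : ‖q‖ < 1) {L : ℂ} (hL0 : L ≠ 0)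
    (hL : Tendsto (qPoch q) atTop (𝓝 L)) (k : ℤ) :
    Tendsto (fun n : ℕ => gaussBinom q (2 * n) (n + k).toNat) atTop (𝓝 L⁻¹) := by
  have h1 : Tendsto (fun n : ℕ => 2 * n) atTop atTop :=
    tendsto_id.const_mul_atTop' two_pos
  have h2 (k : ℤ) : Tendsto (fun n : ℕ => (n + k).toNat) atTop atTop :=
    tendsto_atTop.2 fun b => by
      filter_upwards [eventually_ge_atTop (b + k.natAbs)] with n hn
      omega
  have h := (hL.comp h1).div ((hL.comp (h2 k)).mul (hL.comp (h2 (-k)))) (mul_ne_zero hL0 hL0)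
  rw [show L / (L * L) = L⁻¹ by field_simp] at h
  refine h.congr' ?_
  filter_upwards [eventually_ge_atTop k.natAbs] with n hn
  obtain hs : 2 * n = (n + k).toNat + (n + -k).toNat := by omega
  simp only [Function.comp_apply, Pi.div_apply]
  rw [hs, gaussBinom_eq_div hq]

/-- The truncated Jacobi triple product. -/
lemma prod_mul_prod_eq_tsum {Q : ℂ} (hQ0 : Q ≠ 0) {z : ℂ} (hz : z ≠ 0) (n : ℕ) :
    (∏ j ∈ range n, (1 + Q⁻¹ * z * Q⁻¹ ^ j)) * ∏ j ∈ range n, (1 + z⁻¹ * Q⁻¹ ^ j) =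
      ∑' k : ℤ, if -(n : ℤ) ≤ k then
        gaussBinom Q⁻¹ (2 * n) (n + k).toNat * (Q ^ (-(k * (k + 1)) / 2) * z ^ k) else 0 := by
  have hinj : Function.Injective fun m : ℕ => (m : ℤ) - n := fun a b h => by
    simpa using h
  rw [← hinj.tsum_eq, tsum_eq_sum (s := range (2 * n + 1))]
  rotate_left
  · intro m hm
    have hm' : 2 * n < m := by simpa using hm
    simp [gaussBinom_eq_zero _ hm']
  · intro k hk
    have hk' : -(n : ℤ) ≤ k := by
      by_contra h
      simp [h] at hk
    exact ⟨(k + n).toNat, by simp only; omega⟩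
  have hrefl : ∏ j ∈ range n, (1 + Q⁻¹ ^ j * (Q ^ ((n : ℤ) - 1) * z)) =
      (∏ j ∈ range n, (Q ^ j * z)) * ∏ j ∈ range n, (1 + z⁻¹ * Q⁻¹ ^ j) := by
    rw [← prod_mul_distrib, ← prod_range_reflect]
    refine prod_congr rfl fun j hj => ?_
    have hj' : j < n := by simpa using hj
    have hp : Q⁻¹ ^ (n - 1 - j) * Q ^ ((n : ℤ) - 1) = Q ^ j := by
      rw [inv_pow, ← zpow_natCast, ← zpow_neg, ← zpow_add₀ hQ0, ← zpow_natCast]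
      congr 1
      omega
    have hcancel : Q ^ j * Q⁻¹ ^ j = 1 := by rw [← mul_pow, mul_inv_cancel₀ hQ0, one_pow]
    rw [← mul_assoc, hp]
    linear_combination -hcancel - Q ^ j * Q⁻¹ ^ j * mul_inv_cancel₀ hz
  have htail : ∏ j ∈ range n, (1 + Q⁻¹ ^ (n + j) * (Q ^ ((n : ℤ) - 1) * z)) =
      ∏ j ∈ range n, (1 + Q⁻¹ * z * Q⁻¹ ^ j) := by
    refine prod_congr rfl fun j _ => ?_
    have hp : Q⁻¹ ^ n * Q ^ ((n : ℤ) - 1) = Q⁻¹ := by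
      rw [inv_pow, ← zpow_natCast, ← zpow_neg, ← zpow_add₀ hQ0, ← zpow_neg_one]
      congr 1
      omega
    rw [pow_add]
    linear_combination Q⁻¹ ^ j * z * hp
  have hlead : ∏ j ∈ range n, (Q ^ j * z) = Q ^ n.choose 2 * z ^ n := by
    rw [prod_mul_distrib, prod_pow_eq_pow_sum, prod_const, card_range, sum_range_id,
      Nat.choose_two_right]
  have hlead0 : Q ^ n.choose 2 * z ^ n ≠ 0 := mul_ne_zero (pow_ne_zero _ hQ0) (pow_ne_zero _ hz)
  have hbin := prod_one_add_pow_mul Q⁻¹ (Q ^ ((n : ℤ) - 1) * z) (2 * n)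
  rw [two_mul, prod_range_add, hrefl, htail, hlead, ← two_mul] at hbin
  refine mul_left_cancel₀ hlead0 ?_
  rw [mul_sum, mul_comm (∏ j ∈ range n, _), ← mul_assoc, hbin]
  refine sum_congr rfl fun m _ => ?_
  have hcond : -(n : ℤ) ≤ m - n := by omega
  have htoNat : ((n : ℤ) + (m - n)).toNat = m := by omega
  have hm2 : ((m.choose 2 : ℕ) : ℤ) * 2 = m * (m - 1) := by
    linarith [two_mul_choose_two m]
  have hn2 : ((n.choose 2 : ℕ) : ℤ) * 2 = n * (n - 1) := by
    linarith [two_mul_choose_two n]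
  have h := two_mul_theta_exponent ((m : ℤ) - n)
  have hexp : -((m.choose 2 : ℕ) : ℤ) + ((n : ℤ) - 1) * m =
      (n.choose 2 : ℕ) + -(((m : ℤ) - n) * ((m : ℤ) - n + 1)) / 2 := by linarith
  rw [if_pos hcond, htoNat, inv_pow, mul_pow, ← zpow_natCast Q, ← zpow_neg,
    ← zpow_natCast (Q ^ _), ← zpow_mul, ← zpow_natCast Q]
  have hQe := congrArg (Q ^ ·) hexp
  simp only [zpow_add₀ hQ0] at hQe
  have hzn : z ^ n * (z ^ m / z ^ n) = z ^ m := mul_div_cancel₀ _ (pow_ne_zero _ hz)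
  rw [zpow_sub₀ hz, zpow_natCast z, zpow_natCast z]
  linear_combination gaussBinom Q⁻¹ (2 * n) m * z ^ m * hQe -
    gaussBinom Q⁻¹ (2 * n) m * Q ^ ((n.choose 2 : ℕ) : ℤ) *
      Q ^ (-(((m : ℤ) - n) * ((m : ℤ) - n + 1)) / 2) * hzn

/-- `Θ_Q` vanishes only on `-Q^ℤ`. -/
lemma theta_ne_zero {Q : ℂ} (hQ : 1 < ‖Q‖) {z : ℂ} (hz : z ≠ 0) (hzQ : ∀ k : ℤ, z ≠ -Q ^ k) :
    theta Q z ≠ 0 := by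
  have hQ0 : Q ≠ 0 := norm_pos_iff.mp (by linarith)
  have hq : ‖Q⁻¹‖ < 1 := by rw [norm_inv]; exact inv_lt_one_of_one_lt₀ hQ
  obtain ⟨L, hL0, hL⟩ := exists_tendsto_qPoch hq
  obtain ⟨A, hA0, hA⟩ := exists_tendsto_prod_one_add hq (c := Q⁻¹ * z) fun j h => by
    refine hzQ (j + 1 : ℕ) ?_
    rw [zpow_natCast]
    have hcancel : Q ^ (j + 1) * (Q⁻¹ * Q⁻¹ ^ j) = 1 := by
      rw [← pow_succ', ← mul_pow, mul_inv_cancel₀ hQ0, one_pow]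
    linear_combination Q ^ (j + 1) * h - z * hcancel
  obtain ⟨B, hB0, hB⟩ := exists_tendsto_prod_one_add hq (c := z⁻¹) fun j h => by
    refine hzQ (-(j : ℤ)) ?_
    rw [zpow_neg, zpow_natCast, ← inv_pow]
    linear_combination z * h - Q⁻¹ ^ j * mul_inv_cancel₀ hz
  obtain ⟨C, hC⟩ := exists_norm_gaussBinom_le hq
  have hlim := tendsto_tsum_of_dominated_convergence (𝓕 := atTop)
    (f := fun (n : ℕ) (k : ℤ) => if -(n : ℤ) ≤ k then
      gaussBinom Q⁻¹ (2 * n) (n + k).toNat * (Q ^ (-(k * (k + 1)) / 2) * z ^ k) else 0)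
    (g := fun k : ℤ => L⁻¹ * (Q ^ (-(k * (k + 1)) / 2) * z ^ k))
    ((summable_theta_term hQ hz).norm.mul_left C)
    (fun k => by
      refine ((tendsto_gaussBinom_central hq hL0 hL k).mul_const _).congr' ?_
      filter_upwards [eventually_ge_atTop k.natAbs] with n hn
      rw [if_pos (by omega)])
    (Eventually.of_forall fun n k => by
      split_ifs
      · rw [norm_mul]
        gcongr
        exact hC _ _
      · rw [norm_zero]
        have := (norm_nonneg _).trans (hC 0 0)
        positivity)
  simp only [← prod_mul_prod_eq_tsum hQ0 hz] at hlim
  have huniq := tendsto_nhds_unique hlim (hA.mul hB)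
  rw [tsum_mul_left] at huniq
  intro h0
  rw [theta] at h0
  rw [h0, mul_zero] at huniq
  exact mul_ne_zero hA0 hB0 huniq.symm

lemma theta_div_eq {Q : ℂ} (hQ0 : Q ≠ 0) (z : ℂ) : theta Q (Q / z) = theta Q z := by
  rw [theta, theta, ← (Equiv.neg ℤ).tsum_eq]
  refine tsum_congr fun k => ?_
  have h1 := two_mul_theta_exponent k
  have h2 := two_mul_theta_exponent (-k)
  have h : -(-k * (-k + 1)) / 2 + -k = -(k * (k + 1)) / 2 := by linarith
  rw [Equiv.neg_apply, div_zpow, div_eq_mul_inv, ← mul_assoc, ← zpow_add₀ hQ0, h, zpow_neg, inv_inv]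

/-- For `z ∉ -λQ^ℤ` and `ℓ ∈ ℕ`, `Σ_{k∈ℤ} (Q^kλ)^ℓ/Θ_Q(Q^{k+1}λ/z)` converges
absolutely and sums to `Q^{ℓ(ℓ-1)/2} z^ℓ`. -/
theorem qLaplace_monomial (Q : ℂ) (hQ : 1 < ‖Q‖) (lam : ℂ) (hlam : lam ≠ 0) (ℓ : ℕ)
    (z : ℂ) (hz : z ≠ 0) (hzS : ∀ k : ℤ, z ≠ -lam * Q ^ k) :
    Summable (fun k : ℤ => ‖(Q ^ k * lam) ^ ℓ / theta Q (Q ^ (k + 1) * lam / z)‖) ∧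
    ∑' k : ℤ, (Q ^ k * lam) ^ ℓ / theta Q (Q ^ (k + 1) * lam / z)
      = Q ^ (ℓ * (ℓ - 1) / 2) * z ^ ℓ := by
  have hQ0 : Q ≠ 0 := norm_pos_iff.mp (by linarith)
  have hw : z / lam ≠ 0 := div_ne_zero hz hlam
  have hθ : theta Q (z / lam) ≠ 0 := theta_ne_zero hQ hw fun k h => hzS k (by
    rw [div_eq_iff hlam] at h
    rw [h]
    ring)
  have hterm (k : ℤ) : (Q ^ k * lam) ^ ℓ / theta Q (Q ^ (k + 1) * lam / z) =
      lam ^ ℓ / theta Q (z / lam) *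
        (Q ^ (-(k * (k + 1)) / 2) * (Q ^ (ℓ : ℤ) * (z / lam)) ^ k) := by
    have harg : Q ^ (k + 1) * lam / z = Q ^ k * (Q / (z / lam)) := by
      rw [zpow_add_one₀ hQ0]
      field_simp
    rw [harg, theta_zpow_mul hQ0 (div_ne_zero hQ0 hw), theta_div_eq hQ0, div_zpow, mul_zpow,
      mul_pow, ← zpow_natCast (Q ^ k), ← zpow_mul, ← zpow_mul, mul_comm k]
    have h1 := two_mul_theta_exponent k
    have h : (0 : ℤ) = -(k * (k + 1)) / 2 + (-(k * (k + 1)) / 2 + k * k + k) := by linarith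
    have hQe := congrArg (Q ^ ·) h
    simp only [zpow_add₀ hQ0, zpow_zero] at hQe
    have hwk := zpow_ne_zero k hw
    rw [div_mul_eq_mul_div, div_eq_div_iff _ hθ]
    · rw [zpow_add₀ hQ0]
      field_simp
      linear_combination hQe
    · simp only [ne_eq, mul_eq_zero, div_eq_zero_iff, zpow_ne_zero _ hQ0, hwk, hθ, or_self,
        not_false_eq_true]
  simp only [hterm]
  refine ⟨((summable_theta_term hQ (mul_ne_zero (zpow_ne_zero _ hQ0) hw)).mul_left _).norm, ?_⟩
  rw [tsum_mul_left, ← theta, theta_zpow_mul hQ0 hw]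
  have hexp : -((ℓ : ℤ) * (ℓ + 1)) / 2 + ℓ * ℓ = ((ℓ * (ℓ - 1) / 2 : ℕ) : ℤ) := by
    have h1 := two_mul_theta_exponent ℓ
    have h2 := two_mul_choose_two ℓ
    rw [Nat.choose_two_right] at h2
    linarith
  rw [hexp, zpow_natCast, zpow_natCast, div_pow]
  field_simp
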